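/- arXiv:1810.04807 — 3 statements merged into one kernel-verified Lean document; each statement's English description precedes it below -/
import Mathlib

section
/- Let F be a filtration with associated H_q-persistence module P_q^F, and let c_j (for j in a finite index set J) be degree-q cycles of F(b_j) with associated intervals [b_j, d_j) (1 ≤ b_j < d_j ≤ m+1, where d_j = m+1 encodes +∞). Then {c_j : j ∈ J} is a persistent q-basis for F if and only if P_q^F is isomorphic as a persistence module to ⊕_{j∈J} I^{[b_j,d_j)} and, for every j ∈ J, c_j is a persistent q-cycle for the interval [b_j, d_j). -/
/-- A persistence module over `ZMod 2` indexed by the natural numbers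
(only the indices in `{1,…,n}` will be referred to by the statements). -/
structure PersMod where
  V : ℕ → Type
  [acg : ∀ i, AddCommGroup (V i)]
  [mod : ∀ i, Module (ZMod 2) (V i)]
  map : ∀ {i j : ℕ}, i ≤ j → (V i →ₗ[ZMod 2] V j)
  map_id : ∀ i, map (le_refl i) = LinearMap.id
  map_comp : ∀ {i j k : ℕ} (hij : i ≤ j) (hjk : j ≤ k),
    (map hjk).comp (map hij) = map (hij.trans hjk)

attribute [instance] PersMod.acg PersMod.mod

/-- The direct sum of a finite family of persistence modules. -/
def PersMod.directSum (J : Type) [Fintype J] (Q : J → PersMod) : PersMod where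
  V i := ∀ j, (Q j).V i
  map h := LinearMap.pi fun j => ((Q j).map h).comp (LinearMap.proj j)
  map_id i := by
    ext x j
    simp [PersMod.map_id]
  map_comp hij hjk := by
    ext x j
    simp [← LinearMap.comp_apply, PersMod.map_comp]

/-- The submodule of `ZMod 2` underlying the interval module `I^{[b,d)}` at index `i`. -/
def imSub (b d i : ℕ) : Submodule (ZMod 2) (ZMod 2) :=
  if b ≤ i ∧ i < d then ⊤ else ⊥

/-- The interval module `I^{[b,d)}`: it is `ZMod 2` on indices `b ≤ i < d` and `0`
elsewhere, with identity structure maps inside the interval and zero maps otherwise. -/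
def IntervalMod (b d : ℕ) : PersMod where
  V i := ↥(imSub b d i)
  map {i j} h :=
    { toFun := fun x => ⟨if b ≤ i ∧ j < d then (x : ZMod 2) else 0, by
        by_cases hc : b ≤ i ∧ j < d
        · have : b ≤ j ∧ j < d := ⟨le_trans hc.1 h, hc.2⟩
          simp [hc, imSub, this]
        · simp [hc]⟩
      map_add' := fun x y => by
        apply Subtype.ext
        by_cases hc : b ≤ i ∧ j < d <;> simp [hc]
      map_smul' := fun r x => by
        apply Subtype.ext
        by_cases hc : b ≤ i ∧ j < d <;> simp [hc] }
  map_id i := by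
    ext x
    by_cases hc : b ≤ i ∧ i < d
    · simp [hc]
    · have hx := x.2
      simp only [imSub, if_neg hc, Submodule.mem_bot] at hx
      simp [hc, hx]
  map_comp {i j k} hij hjk := by
    ext x
    simp only [LinearMap.coe_comp, Function.comp_apply, LinearMap.coe_mk, AddHom.coe_mk]
    by_cases h1 : b ≤ i ∧ k < d
    · have h2 : b ≤ i ∧ j < d := ⟨h1.1, lt_of_le_of_lt hjk h1.2⟩
      have h3 : b ≤ j ∧ k < d := ⟨le_trans h1.1 hij, h1.2⟩
      simp [h1, h2, h3]
    · by_cases h2 : b ≤ i ∧ j < d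
      · have h3 : ¬(b ≤ j ∧ k < d) := fun h3 => h1 ⟨h2.1, h3.2⟩
        have h4 : ¬ k < d := fun hk => h1 ⟨h2.1, hk⟩
        simp [h1, h2, h3, h4]
      · simp [h1, h2]

/-- Two persistence modules are isomorphic on the index range `{1,…,n}` if there is
a family of linear isomorphisms on that range commuting with all structure maps
inside the range. -/
def PersMod.IsoOn (P Q : PersMod) (n : ℕ) : Prop :=
  ∃ φ : ∀ i, 1 ≤ i → i ≤ n → (P.V i ≃ₗ[ZMod 2] Q.V i),
    ∀ (i j : ℕ) (hij : i ≤ j) (h1 : 1 ≤ i) (h2 : j ≤ n) (x : P.V i),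
      φ j (h1.trans hij) h2 (P.map hij x) = Q.map hij (φ i h1 (hij.trans h2) x)

/-- A chain complex of vector spaces over `ZMod 2` indexed by the natural numbers;
the differential in degree `n` goes to degree `n - 1` (and is zero in degree `0`). -/
structure ChainCx where
  X : ℕ → Type
  [acg : ∀ n, AddCommGroup (X n)]
  [mod : ∀ n, Module (ZMod 2) (X n)]
  d : ∀ n, X n →ₗ[ZMod 2] X (n - 1)
  d_zero : d 0 = 0
  dd : ∀ n, (d n).comp (d (n + 1)) = 0

attribute [instance] ChainCx.acg ChainCx.mod

/-- The degree-`r` cycles. -/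
def ChainCx.Z (A : ChainCx) (r : ℕ) : Submodule (ZMod 2) (A.X r) :=
  LinearMap.ker (A.d r)

/-- The degree-`r` boundaries. -/
def ChainCx.Bd (A : ChainCx) (r : ℕ) : Submodule (ZMod 2) (A.X r) :=
  LinearMap.range (A.d (r + 1))

/-- The degree-`r` homology: cycles modulo boundaries. -/
def ChainCx.homology (A : ChainCx) (r : ℕ) : Type :=
  ↥(A.Z r) ⧸ (A.Bd r).comap (A.Z r).subtype

instance (A : ChainCx) (r : ℕ) : AddCommGroup (A.homology r) :=
  inferInstanceAs (AddCommGroup (↥(A.Z r) ⧸ (A.Bd r).comap (A.Z r).subtype))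

instance (A : ChainCx) (r : ℕ) : Module (ZMod 2) (A.homology r) :=
  inferInstanceAs (Module (ZMod 2) (↥(A.Z r) ⧸ (A.Bd r).comap (A.Z r).subtype))

/-- The homology class of a cycle. -/
def ChainCx.cls (A : ChainCx) (r : ℕ) (c : A.X r) (hc : c ∈ A.Z r) : A.homology r :=
  Submodule.Quotient.mk ⟨c, hc⟩

/-- A chain map between chain complexes over `ZMod 2`. -/
structure ChainMap (A B : ChainCx) where
  f : ∀ n, A.X n →ₗ[ZMod 2] B.X n
  comm : ∀ n, (B.d n).comp (f n) = (f (n - 1)).comp (A.d n)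

/-- The identity chain map. -/
def ChainMap.id (A : ChainCx) : ChainMap A A where
  f _ := LinearMap.id
  comm _ := rfl

/-- Composition of chain maps. -/
def ChainMap.comp {A B C : ChainCx} (g : ChainMap B C) (f : ChainMap A B) :
    ChainMap A C where
  f n := (g.f n).comp (f.f n)
  comm n := by
    rw [← LinearMap.comp_assoc, g.comm n, LinearMap.comp_assoc, f.comm n,
      ← LinearMap.comp_assoc]

lemma ChainMap.mem_Z {A B : ChainCx} (φ : ChainMap A B) (r : ℕ) {c : A.X r}
    (hc : c ∈ A.Z r) : φ.f r c ∈ B.Z r := by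
  have h := congrArg (fun g => g c) (φ.comm r)
  simp only [LinearMap.coe_comp, Function.comp_apply] at h
  have hc' : A.d r c = 0 := hc
  simp only [ChainCx.Z, LinearMap.mem_ker]
  rw [h, hc', map_zero]

/-- The restriction of a chain map to cycles. -/
def ChainMap.zmap {A B : ChainCx} (φ : ChainMap A B) (r : ℕ) :
    ↥(A.Z r) →ₗ[ZMod 2] ↥(B.Z r) :=
  (φ.f r).restrict fun _ hc => φ.mem_Z r hc

lemma ChainMap.zmap_bd {A B : ChainCx} (φ : ChainMap A B) (r : ℕ) :
    (A.Bd r).comap (A.Z r).subtype ≤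
      Submodule.comap (φ.zmap r) ((B.Bd r).comap (B.Z r).subtype) := by
  rintro ⟨x, hxZ⟩ hx
  simp only [Submodule.mem_comap, Submodule.subtype_apply, ChainCx.Bd,
    LinearMap.mem_range] at hx ⊢
  obtain ⟨y, hy⟩ := hx
  refine ⟨φ.f (r + 1) y, ?_⟩
  have h : B.d (r + 1) (φ.f (r + 1) y) = φ.f r (A.d (r + 1) y) :=
    congrArg (fun g => g y) (φ.comm (r + 1))
  show B.d (r + 1) (φ.f (r + 1) y) = ((φ.zmap r) ⟨x, hxZ⟩ : B.X r)
  exact h.trans (congrArg (φ.f r) hy)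

/-- The induced map on degree-`r` homology. -/
def ChainMap.h {A B : ChainCx} (φ : ChainMap A B) (r : ℕ) :
    A.homology r →ₗ[ZMod 2] B.homology r :=
  Submodule.mapQ _ _ (φ.zmap r) (φ.zmap_bd r)

lemma ChainMap.h_id (A : ChainCx) (r : ℕ) :
    (ChainMap.id A).h r = LinearMap.id := by
  refine Submodule.linearMap_qext _ ?_
  ext x
  rfl

lemma ChainMap.h_comp {A B C : ChainCx} (g : ChainMap B C) (f : ChainMap A B) (r : ℕ) :
    (g.comp f).h r = (g.h r).comp (f.h r) := by
  refine Submodule.linearMap_qext _ ?_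
  ext x
  rfl

/-- A filtration: a functor from `{0,1,…,m}` to chain complexes over `ZMod 2` such that
`F(0)` is the zero complex, each map `F(i−1) → F(i)` is degreewise injective, and the total
dimension grows by exactly one at each step `1 ≤ i ≤ m`, in the single degree `dimσ i`
(the dimension of the `i`-th simplex `σ_i`). -/
structure Filtration (m : ℕ) where
  C : ℕ → ChainCx
  dimσ : ℕ → ℕ
  incl : ∀ {i j : ℕ}, i ≤ j → ChainMap (C i) (C j)
  incl_id : ∀ i, incl (le_refl i) = ChainMap.id (C i)
  incl_comp : ∀ {i j k : ℕ} (hij : i ≤ j) (hjk : j ≤ k),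
    (incl hjk).comp (incl hij) = incl (hij.trans hjk)
  zero_start : ∀ q, Subsingleton ((C 0).X q)
  findim : ∀ i q, FiniteDimensional (ZMod 2) ((C i).X q)
  inj : ∀ i, 1 ≤ i → i ≤ m → ∀ q, Function.Injective ((incl (Nat.sub_le i 1)).f q)
  dim_step : ∀ i, 1 ≤ i → i ≤ m →
    Module.finrank (ZMod 2) ((C i).X (dimσ i))
      = Module.finrank (ZMod 2) ((C (i - 1)).X (dimσ i)) + 1
  dim_eq : ∀ i, 1 ≤ i → i ≤ m → ∀ q, q ≠ dimσ i →
    Module.finrank (ZMod 2) ((C i).X q) = Module.finrank (ZMod 2) ((C (i - 1)).X q)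

/-- A persistent `q`-cycle for the interval `[b,d)` (with `d = m+1` encoding `+∞`):
a degree-`q` cycle of `F(b)` not lying in the image of `F(b−1)`, whose homology class,
in case `d ≤ m`, is nonzero in `H_q(F(d−1))` but zero in `H_q(F(d))`. -/
def IsPersistentCycle {m : ℕ} (F : Filtration m) (q b d : ℕ) (hbd : b < d)
    (c : (F.C b).X q) : Prop :=
  ∃ hc : c ∈ (F.C b).Z q,
    c ∉ LinearMap.range ((F.incl (Nat.sub_le b 1)).f q) ∧
    ∀ _ : d ≤ m,
      (F.C (d - 1)).cls q ((F.incl (Nat.le_pred_of_lt hbd)).f q c)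
          ((F.incl (Nat.le_pred_of_lt hbd)).mem_Z q hc) ≠ 0 ∧
      (F.C d).cls q ((F.incl hbd.le).f q c) ((F.incl hbd.le).mem_Z q hc) = 0

/-- The `H_q`-persistence module of a filtration. -/
def Filtration.Hq {m : ℕ} (F : Filtration m) (q : ℕ) : PersMod where
  V i := (F.C i).homology q
  map h := (F.incl h).h q
  map_id i := by
    show (F.incl (le_refl i)).h q = LinearMap.id
    rw [F.incl_id i]
    exact ChainMap.h_id (F.C i) q
  map_comp {i j k} hij hjk := by
    show ((F.incl hjk).h q).comp ((F.incl hij).h q) = (F.incl (hij.trans hjk)).h q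
    rw [← F.incl_comp hij hjk, ChainMap.h_comp]

/-- `{c_j : j ∈ J}` is a persistent `q`-basis for `F`: there is an isomorphism of persistence
modules (on the index range `{1,…,m}`) between `P_q^F` and `⊕_{j∈J} I^{[b_j,d_j)}` under
which, for `b_j ≤ i < d_j`, the homology class of `c_j` in `H_q(F(i))` corresponds to the
generator of `I^{[b_j,d_j)}(i)`. -/
def IsPersistentBasis {m : ℕ} (F : Filtration m) (q : ℕ) {J : Type} [Fintype J]
    [DecidableEq J] (b d : J → ℕ) (c : ∀ j, (F.C (b j)).X q)
    (hc : ∀ j, c j ∈ (F.C (b j)).Z q) : Prop :=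
  ∃ φ : ∀ i, 1 ≤ i → i ≤ m →
      ((F.Hq q).V i ≃ₗ[ZMod 2] (PersMod.directSum J fun j => IntervalMod (b j) (d j)).V i),
    (∀ (i k : ℕ) (hik : i ≤ k) (h1 : 1 ≤ i) (h2 : k ≤ m) (x : (F.Hq q).V i),
      φ k (h1.trans hik) h2 ((F.Hq q).map hik x)
        = (PersMod.directSum J fun j => IntervalMod (b j) (d j)).map hik
            (φ i h1 (hik.trans h2) x)) ∧
    (∀ (j : J) (i : ℕ) (h1 : 1 ≤ i) (h2 : i ≤ m) (hbi : b j ≤ i) (hid : i < d j),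
      φ i h1 h2 ((F.Hq q).map hbi ((F.C (b j)).cls q (c j) (hc j)))
        = Pi.single j ⟨1, by simp [IntervalMod, imSub, hbi, hid]⟩)

/-- The generator of the `j`-th summand of a direct sum of interval modules, at an index
where that summand is nonzero. -/
def intervalGen {J : Type} [Fintype J] [DecidableEq J] (b d : J → ℕ) (j : J) (i : ℕ)
    (h : b j ≤ i ∧ i < d j) :
    (PersMod.directSum J fun j => IntervalMod (b j) (d j)).V i :=
  Pi.single (M := fun j => (IntervalMod (b j) (d j)).V i) j
    ⟨1, by simp [imSub, h]⟩

/-- The `j`-th coordinate of an element of a direct sum of interval modules. -/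
def intervalCoord {J : Type} [Fintype J] (b d : J → ℕ) (i : ℕ) (j : J) :
    (PersMod.directSum J fun j => IntervalMod (b j) (d j)).V i →ₗ[ZMod 2] ZMod 2 :=
  (imSub (b j) (d j) i).subtype.comp
    (LinearMap.proj (φ := fun j => imSub (b j) (d j) i) j)

section intervalCoord

variable {J : Type} [Fintype J] (b d : J → ℕ)

lemma intervalCoord_ext {i : ℕ} {v w : (PersMod.directSum J fun j => IntervalMod (b j) (d j)).V i}
    (h : ∀ j, intervalCoord b d i j v = intervalCoord b d i j w) : v = w :=
  funext fun j => Subtype.ext (h j)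

lemma intervalCoord_eq_zero {i : ℕ} {j : J} (h : ¬(b j ≤ i ∧ i < d j))
    (v : (PersMod.directSum J fun j => IntervalMod (b j) (d j)).V i) :
    intervalCoord b d i j v = 0 := by
  have hx : intervalCoord b d i j v ∈ imSub (b j) (d j) i := (v j).2
  simpa only [imSub, if_neg h, Submodule.mem_bot] using hx

lemma intervalCoord_map {i k : ℕ} (hik : i ≤ k) (j : J)
    (v : (PersMod.directSum J fun j => IntervalMod (b j) (d j)).V i) :
    intervalCoord b d k j ((PersMod.directSum J fun j => IntervalMod (b j) (d j)).map hik v)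
      = if b j ≤ i ∧ k < d j then intervalCoord b d i j v else 0 :=
  rfl

lemma intervalCoord_intervalGen [DecidableEq J] {i : ℕ} {j : J} (h : b j ≤ i ∧ i < d j) (l : J) :
    intervalCoord b d i l (intervalGen b d j i h) = if l = j then 1 else 0 := by
  by_cases hl : l = j
  · subst hl
    rw [if_pos rfl]
    exact congrArg Subtype.val
      (Pi.single_eq_same (M := fun j => imSub (b j) (d j) i) l ⟨1, by simp [imSub, h]⟩)
  · rw [if_neg hl]
    exact congrArg Subtype.val
      (Pi.single_eq_of_ne (M := fun j => imSub (b j) (d j) i) hl ⟨1, by simp [imSub, h]⟩)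

lemma intervalGen_ne_zero [DecidableEq J] {i : ℕ} {j : J} (h : b j ≤ i ∧ i < d j) :
    intervalGen b d j i h ≠ 0 := by
  intro h0
  have h1 := intervalCoord_intervalGen b d h j
  rw [h0, map_zero, if_pos rfl] at h1
  exact zero_ne_one h1

lemma directSum_map_intervalGen [DecidableEq J] {i k : ℕ} {j : J} (hik : i ≤ k)
    (h : b j ≤ i ∧ i < d j) (hk : d j ≤ k) :
    (PersMod.directSum J fun j => IntervalMod (b j) (d j)).map hik (intervalGen b d j i h)
      = 0 := by
  refine intervalCoord_ext b d fun l => ?_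
  rw [intervalCoord_map, intervalCoord_intervalGen, map_zero]
  split_ifs with h1 hl
  · subst hl
    omega
  · rfl
  · rfl

/-- If no interval is born at `k + 1`, the structure map from `k` to `k + 1` is surjective. -/
lemma directSum_map_succ_surjective (k : ℕ) (hb : ∀ j, b j ≠ k + 1) :
    Function.Surjective
      ((PersMod.directSum J fun j => IntervalMod (b j) (d j)).map k.le_succ) := by
  intro w
  have hw : ∀ j, intervalCoord b d (k + 1) j w ∈ imSub (b j) (d j) k := by
    intro j
    by_cases h : b j ≤ k ∧ k < d j
    · simp [imSub, h]
    · have := hb j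
      rw [intervalCoord_eq_zero b d (by omega)]
      exact zero_mem _
  let v : (PersMod.directSum J fun j => IntervalMod (b j) (d j)).V k :=
    fun j => (⟨_, hw j⟩ : imSub (b j) (d j) k)
  have hv : ∀ j, intervalCoord b d k j v = intervalCoord b d (k + 1) j w := fun _ => rfl
  refine ⟨v, intervalCoord_ext b d fun j => ?_⟩
  rw [intervalCoord_map, hv]
  split_ifs with h
  · rfl
  · have := hb j
    exact (intervalCoord_eq_zero b d (by omega) _).symm

end intervalCoord

/-- If `u` lies outside a subspace whose codimension is at most one over `ZMod 2`, then every
vector is congruent to `0` or to `u` modulo the subspace. -/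
lemma mem_or_sub_mem_of_finrank_le {V W : Type} [AddCommGroup V] [Module (ZMod 2) V]
    [AddCommGroup W] [Module (ZMod 2) W] [FiniteDimensional (ZMod 2) V] (f : W →ₗ[ZMod 2] V)
    (hf : Function.Injective f)
    (hr : Module.finrank (ZMod 2) V ≤ Module.finrank (ZMod 2) W + 1)
    {u : V} (hu : u ∉ LinearMap.range f) (v : V) :
    v ∈ LinearMap.range f ∨ v - u ∈ LinearMap.range f := by
  have h1 := (LinearMap.range f).finrank_quotient_add_finrank
  rw [LinearMap.finrank_range_of_inj hf] at h1
  have hu' : (LinearMap.range f).mkQ u ≠ 0 := by simpa using hu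
  have hpos : Module.finrank (ZMod 2) (V ⧸ LinearMap.range f) = 1 := by
    have : Nontrivial (V ⧸ LinearMap.range f) := ⟨_, _, hu'⟩
    have := Module.finrank_pos (R := ZMod 2) (M := V ⧸ LinearMap.range f)
    omega
  obtain ⟨a, ha⟩ := (finrank_eq_one_iff_of_nonzero' _ hu').1 hpos ((LinearMap.range f).mkQ v)
  have h2 : ∀ a : ZMod 2, a = 0 ∨ a = 1 := by decide
  rcases h2 a with rfl | rfl
  · left
    simpa using ha.symm
  · right
    rw [← Submodule.Quotient.mk_eq_zero, Submodule.Quotient.mk_sub, sub_eq_zero]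
    simpa using ha.symm

namespace Filtration

variable {m : ℕ} (F : Filtration m) (q : ℕ)

/-- The homology class of a cycle, as an element of the persistence module. -/
def hcls {i : ℕ} (z : (F.C i).X q) (hz : z ∈ (F.C i).Z q) : (F.Hq q).V i :=
  (F.C i).cls q z hz

lemma subsingleton_Hq_zero : Subsingleton ((F.Hq q).V 0) := by
  have := F.zero_start q
  refine ⟨fun x y => ?_⟩
  obtain ⟨x, rfl⟩ := Submodule.Quotient.mk_surjective _ x
  obtain ⟨y, rfl⟩ := Submodule.Quotient.mk_surjective _ y
  exact congrArg _ (Subtype.ext (Subsingleton.elim _ _))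

lemma finrank_succ_le {k : ℕ} (hk : k + 1 ≤ m) (q : ℕ) :
    Module.finrank (ZMod 2) ((F.C (k + 1)).X q) ≤ Module.finrank (ZMod 2) ((F.C k).X q) + 1 := by
  by_cases h : q = F.dimσ (k + 1)
  · subst h
    exact (F.dim_step (k + 1) (by omega) hk).le
  · exact (F.dim_eq (k + 1) (by omega) hk q h).le.trans (Nat.le_succ _)

lemma injective_succ {k : ℕ} (hk : k + 1 ≤ m) (q : ℕ) :
    Function.Injective ((F.incl k.le_succ).f q) :=
  F.inj (k + 1) (by omega) hk q

/-- The class of a cycle supported in the previous stage comes from the previous stage. -/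
lemma cls_mem_range {k : ℕ} (hk : k + 1 ≤ m) {z : (F.C (k + 1)).X q}
    (hz : z ∈ (F.C (k + 1)).Z q) (h : z ∈ LinearMap.range ((F.incl k.le_succ).f q)) :
    F.hcls q z hz ∈ LinearMap.range ((F.Hq q).map k.le_succ) := by
  obtain ⟨w, rfl⟩ := h
  have hw : w ∈ (F.C k).Z q := by
    have h1 := congrArg (fun g => g w) ((F.incl k.le_succ).comm q)
    apply F.injective_succ hk (q - 1)
    rw [map_zero]
    exact h1.symm.trans hz
  exact ⟨(F.C k).cls q w hw, rfl⟩

/-- If a cycle at stage `k + 1` contains the new simplex, its class together with the classes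
from stage `k` exhausts the homology at stage `k + 1`. -/
lemma mem_range_or_sub_mem_range {k : ℕ} (hk : k + 1 ≤ m) {u : (F.C (k + 1)).X q}
    (hu : u ∈ (F.C (k + 1)).Z q) (hu' : u ∉ LinearMap.range ((F.incl k.le_succ).f q))
    (x : (F.Hq q).V (k + 1)) :
    x ∈ LinearMap.range ((F.Hq q).map k.le_succ) ∨
      x - F.hcls q u hu ∈ LinearMap.range ((F.Hq q).map k.le_succ) := by
  have := F.findim (k + 1) q
  obtain ⟨⟨z, hz⟩, rfl⟩ := Submodule.Quotient.mk_surjective _ x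
  rcases mem_or_sub_mem_of_finrank_le _ (F.injective_succ hk q) (F.finrank_succ_le hk q) hu' z
    with h | h
  · exact Or.inl (F.cls_mem_range q hk hz h)
  · exact Or.inr (F.cls_mem_range q hk (sub_mem hz hu) h)

end Filtration

namespace PersMod

variable (P : PersMod) {J : Type} (b d : J → ℕ) (g : ∀ j, P.V (b j))

/-- The image at index `i` of an element `g j` born at `b j`, set to zero outside the
interval `[b j, d j)`. -/
def transported (i : ℕ) (j : J) : P.V i :=
  open Classical in if h : b j ≤ i ∧ i < d j then P.map h.1 (g j) else 0

lemma map_map {i j k : ℕ} (hij : i ≤ j) (hjk : j ≤ k) (x : P.V i) :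
    P.map hjk (P.map hij x) = P.map (hij.trans hjk) x :=
  congrArg (fun f => f x) (P.map_comp hij hjk)

lemma transported_of_alive {i : ℕ} {j : J} (h : b j ≤ i ∧ i < d j) :
    P.transported b d g i j = P.map h.1 (g j) :=
  dif_pos h

lemma map_transported {n : ℕ} (hbd : ∀ j, b j < d j)
    (hg : ∀ j, d j ≤ n → P.map (hbd j).le (g j) = 0) {i k : ℕ} (hik : i ≤ k) (hk : k ≤ n)
    {j : J} (h : b j ≤ i ∧ i < d j) :
    P.map hik (P.transported b d g i j) = P.transported b d g k j := by
  rw [transported_of_alive _ _ _ _ h, map_map]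
  by_cases hkd : k < d j
  · rw [transported_of_alive _ _ _ _ ⟨h.1.trans hik, hkd⟩]
  · rw [transported, dif_neg (fun h' => hkd h'.2),
      ← P.map_map (hbd j).le (not_lt.1 hkd), hg j ((not_lt.1 hkd).trans hk), map_zero]

variable [Fintype J]

/-- The linear map sending the generator of the `j`-th interval summand to the corresponding
transported element. -/
def fromIntervals (i : ℕ) :
    (directSum J fun j => IntervalMod (b j) (d j)).V i →ₗ[ZMod 2] P.V i :=
  ∑ j, (LinearMap.toSpanSingleton (ZMod 2) (P.V i) (P.transported b d g i j)).comp
    (intervalCoord b d i j)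

lemma fromIntervals_apply (i : ℕ) (v : (directSum J fun j => IntervalMod (b j) (d j)).V i) :
    P.fromIntervals b d g i v = ∑ j, intervalCoord b d i j v • P.transported b d g i j := by
  simp [fromIntervals]

lemma fromIntervals_intervalGen [DecidableEq J] {i : ℕ} {j : J} (h : b j ≤ i ∧ i < d j) :
    P.fromIntervals b d g i (intervalGen b d j i h) = P.map h.1 (g j) := by
  simp [fromIntervals_apply, intervalCoord_intervalGen, transported_of_alive _ _ _ _ h]

lemma map_fromIntervals {n : ℕ} (hbd : ∀ j, b j < d j)
    (hg : ∀ j, d j ≤ n → P.map (hbd j).le (g j) = 0) {i k : ℕ} (hik : i ≤ k) (hk : k ≤ n)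
    (v : (directSum J fun j => IntervalMod (b j) (d j)).V i) :
    P.fromIntervals b d g k ((directSum J fun j => IntervalMod (b j) (d j)).map hik v)
      = P.map hik (P.fromIntervals b d g i v) := by
  rw [fromIntervals_apply, fromIntervals_apply, map_sum]
  refine Finset.sum_congr rfl fun j _ => ?_
  rw [intervalCoord_map, map_smul]
  by_cases h : b j ≤ i ∧ i < d j
  · rw [P.map_transported b d g hbd hg hik hk h]
    by_cases hkd : k < d j
    · rw [if_pos ⟨h.1, hkd⟩]
    · rw [if_neg (fun h' => hkd h'.2), transported, dif_neg (fun h' => hkd h'.2), smul_zero,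
        smul_zero]
  · rw [if_neg (fun h' => h ⟨h'.1, hik.trans_lt h'.2⟩), intervalCoord_eq_zero b d h, zero_smul,
      zero_smul]

/-- The transported elements span every stage, provided that at each step either the structure
map is surjective or a newborn element spans its cokernel. -/
lemma fromIntervals_surjective {n : ℕ} (h0 : Subsingleton (P.V 0)) (hbd : ∀ j, b j < d j)
    (hg : ∀ j, d j ≤ n → P.map (hbd j).le (g j) = 0)
    (hstep : ∀ k, k + 1 ≤ n → ∀ x : P.V (k + 1), x ∈ LinearMap.range (P.map k.le_succ) ∨
      ∃ (j : J) (h : b j = k + 1), x - P.map h.le (g j) ∈ LinearMap.range (P.map k.le_succ))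
    {i : ℕ} (hi : i ≤ n) : Function.Surjective (P.fromIntervals b d g i) := by
  classical
  induction i with
  | zero => exact fun x => ⟨0, Subsingleton.elim _ _⟩
  | succ k ih =>
    have hr : LinearMap.range (P.map k.le_succ)
        ≤ LinearMap.range (P.fromIntervals b d g (k + 1)) := by
      rintro _ ⟨y, rfl⟩
      obtain ⟨v, rfl⟩ := ih (by omega) y
      exact ⟨_, P.map_fromIntervals b d g hbd hg k.le_succ hi v⟩
    intro x
    rcases hstep k hi x with h | ⟨j, h, hx⟩
    · exact hr h
    · have hj : b j ≤ k + 1 ∧ k + 1 < d j := ⟨h.le, h ▸ hbd j⟩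
      have hmem := add_mem (hr hx)
        (LinearMap.mem_range.2 ⟨_, P.fromIntervals_intervalGen b d g hj⟩)
      rwa [sub_add_cancel] at hmem

/-- A surjective `fromIntervals` is bijective as soon as source and target are isomorphic. -/
lemma fromIntervals_bijective {i : ℕ}
    (e : P.V i ≃ₗ[ZMod 2] (directSum J fun j => IntervalMod (b j) (d j)).V i)
    (h : Function.Surjective (P.fromIntervals b d g i)) :
    Function.Bijective (P.fromIntervals b d g i) := by
  have hfin : FiniteDimensional (ZMod 2) ((directSum J fun j => IntervalMod (b j) (d j)).V i) :=
    inferInstanceAs (FiniteDimensional (ZMod 2) (∀ j, imSub (b j) (d j) i))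
  have hinj : Function.Injective (e.toLinearMap.comp (P.fromIntervals b d g i)) :=
    LinearMap.injective_iff_surjective.2 (e.surjective.comp h)
  exact ⟨hinj.of_comp (f := e), h⟩

end PersMod

lemma isPersistentCycle_of_isPersistentBasis {m : ℕ} {F : Filtration m} {q : ℕ} {J : Type}
    [Fintype J] [DecidableEq J] {b d : J → ℕ} (hb : ∀ j, 1 ≤ b j) (hbd : ∀ j, b j < d j)
    (hd : ∀ j, d j ≤ m + 1) {c : ∀ j, (F.C (b j)).X q} {hc : ∀ j, c j ∈ (F.C (b j)).Z q}
    (h : IsPersistentBasis F q b d c hc) (j : J) :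
    IsPersistentCycle F q (b j) (d j) (hbd j) (c j) := by
  obtain ⟨φ, hnat, hgen⟩ := h
  have hb1 := hb j
  have hbdj := hbd j
  have hdj := hd j
  have hgen' : ∀ (i : ℕ) (h1 : 1 ≤ i) (h2 : i ≤ m) (h : b j ≤ i ∧ i < d j),
      φ i h1 h2 ((F.Hq q).map h.1 (F.hcls q (c j) (hc j))) = intervalGen b d j i h :=
    fun i h1 h2 h => hgen j i h1 h2 h.1 h.2
  refine ⟨hc j, fun hmem => ?_, fun hdm => ⟨fun h0 => ?_, ?_⟩⟩
  · have hφ := hgen' (b j) hb1 (by omega) ⟨le_rfl, hbdj⟩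
    rw [PersMod.map_id, LinearMap.id_apply] at hφ
    have hrange : ∀ (n : ℕ) (hn : n ≤ m) (hn1 : 1 ≤ n) (z : (F.C n).X q) (hz : z ∈ (F.C n).Z q),
        z ∈ LinearMap.range ((F.incl (Nat.sub_le n 1)).f q) →
        F.hcls q z hz ∈ LinearMap.range ((F.Hq q).map (Nat.sub_le n 1)) := by
      rintro (_ | k) hn hn1 z hz hmem
      · omega
      · exact F.cls_mem_range q hn hz hmem
    obtain ⟨y, hy⟩ := hrange _ (by omega) hb1 _ (hc j) hmem
    rw [← hy] at hφ
    by_cases hb0 : b j - 1 = 0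
    · have hsub : Subsingleton ((F.Hq q).V (b j - 1)) := hb0 ▸ F.subsingleton_Hq_zero q
      rw [Subsingleton.elim y 0, map_zero, map_zero] at hφ
      exact intervalGen_ne_zero b d _ hφ.symm
    · rw [hnat _ _ _ (by omega)] at hφ
      have hval := intervalCoord_map b d (Nat.sub_le (b j) 1) j
        (φ (b j - 1) (by omega) (by omega) y)
      rw [hφ, if_neg (by omega), intervalCoord_intervalGen, if_pos rfl] at hval
      exact one_ne_zero hval
  · have hφ := hgen' (d j - 1) (by omega) (by omega) ⟨by omega, by omega⟩
    have h0' : (F.Hq q).map (Nat.le_pred_of_lt hbdj) (F.hcls q (c j) (hc j)) = 0 := h0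
    rw [h0', map_zero] at hφ
    exact intervalGen_ne_zero b d _ hφ.symm
  · have hφ := hgen' (b j) hb1 (by omega) ⟨le_rfl, hbdj⟩
    rw [PersMod.map_id, LinearMap.id_apply] at hφ
    have hφd := hnat (b j) (d j) hbdj.le hb1 hdm (F.hcls q (c j) (hc j))
    rw [hφ, directSum_map_intervalGen b d _ _ le_rfl] at hφd
    exact (LinearEquiv.map_eq_zero_iff _).1 hφd

lemma isPersistentBasis_of_isPersistentCycle {m : ℕ} {F : Filtration m} {q : ℕ} {J : Type}
    [Fintype J] [DecidableEq J] {b d : J → ℕ} (hb : ∀ j, 1 ≤ b j)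
    (hbd : ∀ j, b j < d j) {c : ∀ j, (F.C (b j)).X q} (hc : ∀ j, c j ∈ (F.C (b j)).Z q)
    (hiso : PersMod.IsoOn (F.Hq q) (PersMod.directSum J fun j => IntervalMod (b j) (d j)) m)
    (hcyc : ∀ j, IsPersistentCycle F q (b j) (d j) (hbd j) (c j)) :
    IsPersistentBasis F q b d c hc := by
  obtain ⟨φ, hφ⟩ := hiso
  let g : ∀ j, (F.Hq q).V (b j) := fun j => F.hcls q (c j) (hc j)
  have hg : ∀ j, d j ≤ m → (F.Hq q).map (hbd j).le (g j) = 0 := by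
    intro j hj
    obtain ⟨_, _, h⟩ := hcyc j
    exact (h hj).2
  have hborn : ∀ (k n : ℕ) (_ : k + 1 ≤ m) (h : n = k + 1) (z : (F.C n).X q)
      (hz : z ∈ (F.C n).Z q), z ∉ LinearMap.range ((F.incl (Nat.sub_le n 1)).f q) →
      ∀ x : (F.Hq q).V (k + 1), x ∈ LinearMap.range ((F.Hq q).map k.le_succ) ∨
        x - (F.Hq q).map h.le (F.hcls q z hz)
          ∈ LinearMap.range ((F.Hq q).map k.le_succ) := by
    rintro k _ hk rfl z hz hmem x
    rw [PersMod.map_id]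
    exact F.mem_range_or_sub_mem_range q hk hz hmem x
  have hstep : ∀ k, k + 1 ≤ m → ∀ x : (F.Hq q).V (k + 1),
      x ∈ LinearMap.range ((F.Hq q).map k.le_succ) ∨ ∃ (j : J) (h : b j = k + 1),
        x - (F.Hq q).map h.le (g j) ∈ LinearMap.range ((F.Hq q).map k.le_succ) := by
    intro k hk x
    by_cases hex : ∃ j, b j = k + 1
    · obtain ⟨j, hj⟩ := hex
      obtain ⟨_, hmem, _⟩ := hcyc j
      exact (hborn k _ hk hj _ (hc j) hmem x).imp_right fun h => ⟨j, hj, h⟩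
    · left
      obtain ⟨w, hw⟩ := directSum_map_succ_surjective b d k (fun j hj => hex ⟨j, hj⟩)
        (φ (k + 1) (by omega) hk x)
      rcases Nat.eq_zero_or_pos k with rfl | hk1
      · have hw0 : w = 0 := intervalCoord_ext b d fun j =>
          (intervalCoord_eq_zero b d (fun h' => absurd ((hb j).trans h'.1) (by omega)) _).trans
            (map_zero _).symm
        rw [hw0, map_zero, eq_comm, LinearEquiv.map_eq_zero_iff] at hw
        rw [hw]
        exact zero_mem _
      · refine ⟨(φ k hk1 (by omega)).symm w, (φ (k + 1) (by omega) hk).injective ?_⟩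
        rw [hφ k (k + 1) _ hk1 hk, LinearEquiv.apply_symm_apply, hw]
  have hbij : ∀ i (h1 : 1 ≤ i) (h2 : i ≤ m),
      Function.Bijective ((F.Hq q).fromIntervals b d g i) := fun i h1 h2 =>
    (F.Hq q).fromIntervals_bijective b d g (φ i h1 h2)
      ((F.Hq q).fromIntervals_surjective b d g (F.subsingleton_Hq_zero q) hbd hg hstep h2)
  refine ⟨fun i h1 h2 => (LinearEquiv.ofBijective _ (hbij i h1 h2)).symm, ?_, ?_⟩
  · intro i k hik h1 h2 x
    obtain ⟨v, rfl⟩ := (hbij i h1 (hik.trans h2)).2 x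
    rw [LinearEquiv.symm_apply_eq, LinearEquiv.ofBijective_symm_apply_apply]
    exact ((F.Hq q).map_fromIntervals b d g hbd hg hik h2 v).symm
  · intro j i h1 h2 hbi hid
    refine (LinearEquiv.symm_apply_eq _).2 ?_
    exact ((F.Hq q).fromIntervals_intervalGen b d g ⟨hbi, hid⟩).symm

/-- An indexed set of degree-`q` cycles `{c_j : j ∈ J}` with intervals
`[b_j, d_j)` is a persistent `q`-basis for a filtration `F` if and only if
`P_q^F ≅ ⊕_{j∈J} I^{[b_j,d_j)}` and each `c_j` is a persistent `q`-cycle for `[b_j, d_j)`. -/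
theorem statement_1 (m : ℕ) (F : Filtration m) (q : ℕ) (J : Type) [Fintype J]
    [DecidableEq J] (b d : J → ℕ)
    (hb : ∀ j, 1 ≤ b j) (hbd : ∀ j, b j < d j) (hd : ∀ j, d j ≤ m + 1)
    (c : ∀ j, (F.C (b j)).X q) (hc : ∀ j, c j ∈ (F.C (b j)).Z q) :
    IsPersistentBasis F q b d c hc ↔
      (PersMod.IsoOn (F.Hq q) (PersMod.directSum J fun j => IntervalMod (b j) (d j)) m ∧
        ∀ j, IsPersistentCycle F q (b j) (d j) (hbd j) (c j)) := by
  refine ⟨fun h => ⟨?_, isPersistentCycle_of_isPersistentBasis hb hbd hd h⟩,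
    fun h => isPersistentBasis_of_isPersistentCycle hb hbd hc h.1 h.2⟩
  obtain ⟨φ, hφ, _⟩ := h
  exact ⟨φ, hφ⟩
end

section
/- Let P be a persistence module indexed by {1,…,n}, let J be a finite index set, and for each j ∈ J let [b_j, d_j) be an interval with 1 ≤ b_j < d_j ≤ n+1 together with an element x_j ∈ P(b_j). Suppose that (a) for every 1 ≤ i ≤ n, the family (P[b_j ≤ i](x_j))_{j ∈ J, b_j ≤ i < d_j} is a basis of the vector space P(i), and (b) for every j ∈ J with d_j ≤ n, P[b_j ≤ d_j](x_j) = 0. Then P is isomorphic as a persistence module to ⊕_{j∈J} I^{[b_j,d_j)}, via an isomorphism under which, for each j ∈ J and each i with b_j ≤ i < d_j, the generator of I^{[b_j,d_j)}(i) corresponds to P[b_j ≤ i](x_j). -/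
lemma one_mem_imSub {b d i : ℕ} (h : b ≤ i ∧ i < d) : (1 : ZMod 2) ∈ imSub b d i := by
  simp [imSub, h]

/-- Coordinate families supported on the intervals alive at `i`, extended by zero to the direct sum
of the interval modules at `i`. -/
def intervalSumEquiv {J : Type} (b d : J → ℕ) (i : ℕ) :
    ({j : J // b j ≤ i ∧ i < d j} → ZMod 2) ≃ₗ[ZMod 2] (∀ j, imSub (b j) (d j) i) where
  toFun f j := ⟨if h : b j ≤ i ∧ i < d j then f ⟨j, h⟩ else 0, by
    by_cases h : b j ≤ i ∧ i < d j <;> simp [h, imSub]⟩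
  invFun y j := y j.1
  map_add' f g := by
    ext j
    by_cases h : b j ≤ i ∧ i < d j <;> simp [h]
  map_smul' r f := by
    ext j
    by_cases h : b j ≤ i ∧ i < d j <;> simp [h]
  left_inv f := by
    ext j
    simp [j.2]
  right_inv y := by
    ext j
    by_cases h : b j ≤ i ∧ i < d j
    · simp [h]
    · have hy := (y j).2
      simp only [imSub, if_neg h, Submodule.mem_bot] at hy
      simp [h, hy]

lemma intervalSumEquiv_single {J : Type} [DecidableEq J] (b d : J → ℕ) (i : ℕ)
    (j : {j : J // b j ≤ i ∧ i < d j}) :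
    intervalSumEquiv b d i (Pi.single j 1) = Pi.single j.1 ⟨1, one_mem_imSub j.2⟩ := by
  funext l
  apply Subtype.ext
  rcases eq_or_ne l j.1 with rfl | hl
  · simp [intervalSumEquiv, j.2]
  · have hne (h : b l ≤ i ∧ i < d l) : (⟨l, h⟩ : {j : J // b j ≤ i ∧ i < d j}) ≠ j :=
      fun e => hl (congrArg Subtype.val e)
    simp [intervalSumEquiv, hl, hne]

lemma PersMod.directSum_map_single {J : Type} [Fintype J] [DecidableEq J] (Q : J → PersMod)
    {i k : ℕ} (hik : i ≤ k) (j : J) (v : (Q j).V i) :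
    (PersMod.directSum J Q).map hik (Pi.single j v : ∀ j, (Q j).V i) =
      (Pi.single j ((Q j).map hik v) : ∀ j, (Q j).V k) := by
  funext l
  exact Pi.apply_single (fun l => (Q l).map hik) (fun l => map_zero _) j v l

lemma PersMod.map_map_s2 (P : PersMod) {i j k : ℕ} (hij : i ≤ j) (hjk : j ≤ k) (v : P.V i) :
    P.map hjk (P.map hij v) = P.map (hij.trans hjk) v := by
  rw [← P.map_comp hij hjk, LinearMap.comp_apply]

/-- If a persistence module `P` has elements `x_j ∈ P(b_j)` whose pushforwards
form a basis of `P(i)` at every index `1 ≤ i ≤ n` (taking those `j` with `b_j ≤ i < d_j`),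
and each `x_j` dies at `d_j` (when `d_j ≤ n`), then `P` is isomorphic to the direct sum of the
interval modules `I^{[b_j,d_j)}`, via an isomorphism matching the pushforward of `x_j` with the
generator of the `j`-th interval module. -/
theorem statement_2 (n : ℕ) (P : PersMod) (J : Type) [Fintype J] [DecidableEq J]
    (b d : J → ℕ) (hb : ∀ j, 1 ≤ b j) (hbd : ∀ j, b j < d j) (hd : ∀ j, d j ≤ n + 1)
    (x : ∀ j, P.V (b j))
    (hbasis : ∀ (i : ℕ), 1 ≤ i → i ≤ n →
      LinearIndependent (ZMod 2)
        (fun j : {j : J // b j ≤ i ∧ i < d j} => P.map j.2.1 (x j.1)) ∧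
      Submodule.span (ZMod 2)
        (Set.range (fun j : {j : J // b j ≤ i ∧ i < d j} => P.map j.2.1 (x j.1))) = ⊤)
    (hdeath : ∀ j, d j ≤ n → P.map (le_of_lt (hbd j)) (x j) = 0) :
    ∃ φ : ∀ i, 1 ≤ i → i ≤ n →
        (P.V i ≃ₗ[ZMod 2] (PersMod.directSum J fun j => IntervalMod (b j) (d j)).V i),
      (∀ (i k : ℕ) (hik : i ≤ k) (h1 : 1 ≤ i) (h2 : k ≤ n) (y : P.V i),
        φ k (h1.trans hik) h2 (P.map hik y)
          = (PersMod.directSum J fun j => IntervalMod (b j) (d j)).map hik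
              (φ i h1 (hik.trans h2) y)) ∧
      (∀ (j : J) (i : ℕ) (h1 : 1 ≤ i) (h2 : i ≤ n) (hbi : b j ≤ i) (hid : i < d j),
        φ i h1 h2 (P.map hbi (x j))
          = Pi.single j ⟨1, by simp [IntervalMod, imSub, hbi, hid]⟩) := by
  let B (i : ℕ) (h1 : 1 ≤ i) (h2 : i ≤ n) :
      Module.Basis {j : J // b j ≤ i ∧ i < d j} (ZMod 2) (P.V i) :=
    Module.Basis.mk (hbasis i h1 h2).1 (hbasis i h1 h2).2.ge
  let φ (i : ℕ) (h1 : 1 ≤ i) (h2 : i ≤ n) : P.V i ≃ₗ[ZMod 2] (∀ j, imSub (b j) (d j) i) :=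
    (B i h1 h2).equivFun.trans (intervalSumEquiv b d i)
  have hφ (j : J) (i : ℕ) (h1 : 1 ≤ i) (h2 : i ≤ n) (hbi : b j ≤ i) (hid : i < d j) :
      φ i h1 h2 (P.map hbi (x j)) =
        (Pi.single j ⟨1, one_mem_imSub ⟨hbi, hid⟩⟩ : ∀ j, imSub (b j) (d j) i) := by
    have hB : B i h1 h2 ⟨j, hbi, hid⟩ = P.map hbi (x j) := Module.Basis.mk_apply _ _ _
    have hcoord : (B i h1 h2).equivFun (B i h1 h2 ⟨j, hbi, hid⟩) = Pi.single ⟨j, hbi, hid⟩ 1 := by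
      ext l
      rw [Module.Basis.equivFun_self, Pi.single_apply]
      simp only [eq_comm]
    rw [← hB, LinearEquiv.trans_apply, hcoord]
    exact intervalSumEquiv_single b d i ⟨j, hbi, hid⟩
  refine ⟨φ, fun i k hik h1 h2 y => ?_, hφ⟩
  let D : (∀ j, imSub (b j) (d j) i) →ₗ[ZMod 2] (∀ j, imSub (b j) (d j) k) :=
    (PersMod.directSum J fun j => IntervalMod (b j) (d j)).map hik
  have hD (j : J) (v : imSub (b j) (d j) i) :
      D (Pi.single j v) = Pi.single j ((IntervalMod (b j) (d j)).map hik v) :=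
    PersMod.directSum_map_single (fun j => IntervalMod (b j) (d j)) hik j v
  suffices h : (φ k (h1.trans hik) h2).toLinearMap ∘ₗ P.map hik =
      D ∘ₗ (φ i h1 (hik.trans h2)).toLinearMap from LinearMap.congr_fun h y
  refine (B i h1 (hik.trans h2)).ext fun ⟨j, hbi, hid⟩ => ?_
  have hB : B i h1 (hik.trans h2) ⟨j, hbi, hid⟩ = P.map hbi (x j) := Module.Basis.mk_apply _ _ _
  simp only [hB, LinearMap.comp_apply, LinearEquiv.coe_coe]
  rw [hφ j i h1 (hik.trans h2) hbi hid, PersMod.map_map_s2, hD]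
  by_cases hkd : k < d j
  · rw [hφ j k (h1.trans hik) h2 (hbi.trans hik) hkd]
    exact congrArg (Pi.single j) (Subtype.ext (if_pos ⟨hbi, hkd⟩).symm)
  · have hdk : d j ≤ k := not_lt.mp hkd
    rw [← PersMod.map_map_s2 P (hbd j).le hdk, hdeath j (hdk.trans h2), map_zero, map_zero]
    refine (Pi.single_eq_zero_iff.mpr ?_).symm
    exact Subtype.ext (if_neg fun h => hkd h.2)
end

section
/- Let F be a filtration and suppose its H_q-persistence module P_q^F is isomorphic to ⊕_{j∈J} I^{[b_j,d_j)} for a finite family of intervals [b_j, d_j), j ∈ J. If j₀ ∈ J and c is a persistent q-cycle for the interval [b_{j₀}, d_{j₀}), then there exists a persistent q-basis {c_j : j ∈ J} for F, with the same intervals [b_j, d_j), such that c_{j₀} = c. In particular, any persistent q-cycle for an interval of the decomposition can serve as the representative of the corresponding interval module in some interval module decomposition of P_q^F. -/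
lemma eq_zero_of_mem_imSub {b d i : ℕ} {x : ZMod 2} (hx : x ∈ imSub b d i)
    (h : ¬(b ≤ i ∧ i < d)) : x = 0 := by
  simpa [imSub, h] using hx

lemma mem_imSub_of_imp {b d i : ℕ} {x : ZMod 2} (h : x ≠ 0 → b ≤ i ∧ i < d) :
    x ∈ imSub b d i := by
  by_cases hx : x = 0
  · simp [hx]
  · simp [imSub, h hx]

/-- The elementary endomorphism `v ↦ v + v_{j₀} • a` of a direct sum of interval modules, at
index `i`, where `a` is supported on intervals starting and ending no later than the `j₀`-th. -/
def intervalShear {J : Type} (b d : J → ℕ) (j₀ : J) (a : J → ZMod 2)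
    (ha : ∀ j, a j ≠ 0 → b j ≤ b j₀ ∧ d j ≤ d j₀) (i : ℕ) :
    (∀ j, ↥(imSub (b j) (d j) i)) →ₗ[ZMod 2] (∀ j, ↥(imSub (b j) (d j) i)) where
  toFun v j := ⟨(v j : ZMod 2) + if i < d j then a j * v j₀ else 0, by
    refine Submodule.add_mem _ (v j).2 (mem_imSub_of_imp fun h => ?_)
    split_ifs at h with hi
    · refine ⟨(ha j (left_ne_zero_of_mul h)).1.trans ?_, hi⟩
      by_contra hlt
      exact right_ne_zero_of_mul h (eq_zero_of_mem_imSub (v j₀).2 fun h' => hlt h'.1)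
    · exact absurd rfl h⟩
  map_add' v w := by
    ext j
    by_cases hi : i < d j
    · simp [hi]; ring
    · simp [hi]
  map_smul' r v := by
    ext j
    by_cases hi : i < d j
    · simp [hi]; ring
    · simp [hi]

lemma intervalShear_apply {J : Type} {b d : J → ℕ} {j₀ : J} {a : J → ZMod 2}
    (ha : ∀ j, a j ≠ 0 → b j ≤ b j₀ ∧ d j ≤ d j₀) {i : ℕ}
    (v : ∀ j, ↥(imSub (b j) (d j) i)) (j : J) :
    (intervalShear b d j₀ a ha i v j : ZMod 2) = v j + if i < d j then a j * v j₀ else 0 :=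
  rfl

lemma intervalShear_involutive {J : Type} {b d : J → ℕ} {j₀ : J} {a : J → ZMod 2}
    (ha : ∀ j, a j ≠ 0 → b j ≤ b j₀ ∧ d j ≤ d j₀) (ha₀ : a j₀ = 0) (i : ℕ) :
    Function.Involutive (intervalShear b d j₀ a ha i) := by
  intro v
  ext j
  simp only [intervalShear_apply, ha₀, zero_mul, ite_self, add_zero]
  rw [add_assoc, CharTwo.add_self_eq_zero, add_zero]

lemma directSum_intervalMod_map_apply {J : Type} [Fintype J] {b d : J → ℕ} {i k : ℕ}
    (hik : i ≤ k) (v : ∀ j, ↥(imSub (b j) (d j) i)) (j : J) :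
    Subtype.val (p := (· ∈ imSub (b j) (d j) k))
      ((PersMod.directSum J fun j => IntervalMod (b j) (d j)).map hik v j)
      = if b j ≤ i ∧ k < d j then (v j : ZMod 2) else 0 :=
  rfl

lemma intervalShear_natural {J : Type} [Fintype J] {b d : J → ℕ} {j₀ : J} {a : J → ZMod 2}
    (ha : ∀ j, a j ≠ 0 → b j ≤ b j₀ ∧ d j ≤ d j₀) {i k : ℕ} (hik : i ≤ k)
    (v : ∀ j, ↥(imSub (b j) (d j) i)) :
    intervalShear b d j₀ a ha k
        ((PersMod.directSum J fun j => IntervalMod (b j) (d j)).map hik v)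
      = (PersMod.directSum J fun j => IntervalMod (b j) (d j)).map hik
          (intervalShear b d j₀ a ha i v) := by
  funext j
  apply Subtype.ext
  refine Eq.trans (intervalShear_apply ha _ j) ?_
  refine Eq.trans ?_ (directSum_intervalMod_map_apply hik _ j).symm
  rw [intervalShear_apply]
  erw [directSum_intervalMod_map_apply hik v j, directSum_intervalMod_map_apply hik v j₀]
  by_cases haj : a j = 0
  · simp [haj]
  obtain ⟨hb, hd⟩ := ha j haj
  by_cases hk : k < d j
  · have hi : i < d j := hik.trans_lt hk
    have hk₀ : k < d j₀ := hk.trans_le hd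
    by_cases hbi : b j₀ ≤ i
    · simp [hk, hi, hk₀, hbi, hb.trans hbi]
    · have hv : (v j₀ : ZMod 2) = 0 := eq_zero_of_mem_imSub (v j₀).2 fun h => hbi h.1
      simp [hk, hv]
  · simp [hk]

/-- An element born with the `j₀`-th interval, with nonzero `j₀`-th component and no component
outliving that interval, is the `j₀`-th generator in some interval decomposition. -/
lemma exists_decomposition_apply_eq_single {J : Type} [Fintype J] [DecidableEq J] {b d : J → ℕ}
    {P : PersMod} {m : ℕ} (φ : ∀ i, 1 ≤ i → i ≤ m →
      (P.V i ≃ₗ[ZMod 2] (PersMod.directSum J fun j => IntervalMod (b j) (d j)).V i))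
    (hφ : ∀ (i k : ℕ) (hik : i ≤ k) (h1 : 1 ≤ i) (h2 : k ≤ m) (x : P.V i),
      φ k (h1.trans hik) h2 (P.map hik x)
        = (PersMod.directSum J fun j => IntervalMod (b j) (d j)).map hik
            (φ i h1 (hik.trans h2) x))
    {j₀ : J} (h1 : 1 ≤ b j₀) (h2 : b j₀ ≤ m) (hbd : b j₀ < d j₀) (x : P.V (b j₀))
    (v : ∀ j, ↥(imSub (b j) (d j) (b j₀))) (hxv : φ (b j₀) h1 h2 x = v)
    (hx₀ : (v j₀ : ZMod 2) = 1) (hx : ∀ j, (v j : ZMod 2) ≠ 0 → d j ≤ d j₀) :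
    ∃ φ' : ∀ i, 1 ≤ i → i ≤ m →
        (P.V i ≃ₗ[ZMod 2] (PersMod.directSum J fun j => IntervalMod (b j) (d j)).V i),
      (∀ (i k : ℕ) (hik : i ≤ k) (h1 : 1 ≤ i) (h2 : k ≤ m) (x : P.V i),
        φ' k (h1.trans hik) h2 (P.map hik x)
          = (PersMod.directSum J fun j => IntervalMod (b j) (d j)).map hik
              (φ' i h1 (hik.trans h2) x)) ∧
      φ' (b j₀) h1 h2 x
        = Pi.single j₀ ⟨1, by simp [imSub, hbd]⟩ := by
  have hsupp (j : J) (hj : (v j : ZMod 2) ≠ 0) : b j ≤ b j₀ ∧ b j₀ < d j := by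
    by_contra h
    exact hj (eq_zero_of_mem_imSub (v j).2 h)
  let a : J → ZMod 2 := fun j => if j = j₀ then 0 else v j
  have ha₀ : a j₀ = 0 := if_pos rfl
  have ha (j : J) (hj : a j ≠ 0) : b j ≤ b j₀ ∧ d j ≤ d j₀ := by
    have hvj : (v j : ZMod 2) ≠ 0 := fun h => hj (by simp [a, h])
    exact ⟨(hsupp j hvj).1, hx j hvj⟩
  let T (i : ℕ) : (∀ j, ↥(imSub (b j) (d j) i)) ≃ₗ[ZMod 2] (∀ j, ↥(imSub (b j) (d j) i)) :=
    LinearEquiv.ofInvolutive _ (intervalShear_involutive ha ha₀ i)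
  refine ⟨fun i h1 h2 => (φ i h1 h2).trans (T i), fun i k hik h1 h2 y => ?_, ?_⟩
  · exact (congrArg (T k) (hφ i k hik h1 h2 y)).trans (intervalShear_natural ha hik _)
  · refine (congrArg (T (b j₀)) hxv).trans ?_
    funext j
    apply Subtype.ext
    refine (intervalShear_apply ha v j).trans ?_
    by_cases hj : j = j₀
    · subst hj
      erw [Pi.single_eq_same]
      simp [ha₀, hx₀]
    · erw [Pi.single_eq_of_ne hj]
      change _ = (0 : ZMod 2)
      by_cases hvj : (v j : ZMod 2) = 0
      · simp [a, hvj]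
      · simp [a, hj, hx₀, (hsupp j hvj).2, CharTwo.add_self_eq_zero]

lemma directSum_intervalMod_map_single {J : Type} [Fintype J] [DecidableEq J] {b d : J → ℕ}
    {i k : ℕ} (hik : i ≤ k) (j : J) (hbi : b j ≤ i) (hk : k < d j) :
    (PersMod.directSum J fun j => IntervalMod (b j) (d j)).map hik
        (Pi.single j ⟨1, by simp [imSub, hbi, hik.trans_lt hk]⟩)
      = Pi.single j ⟨1, by simp [imSub, hbi.trans hik, hk]⟩ := by
  funext l
  apply Subtype.ext
  refine (directSum_intervalMod_map_apply hik _ l).trans ?_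
  by_cases hl : l = j
  · subst hl
    erw [Pi.single_eq_same, Pi.single_eq_same]
    simp [hbi, hk]
  · erw [Pi.single_eq_of_ne hl, Pi.single_eq_of_ne hl]
    exact ite_self _

lemma ChainCx.exists_cls_eq (A : ChainCx) (r : ℕ) (x : A.homology r) :
    ∃ (c : A.X r) (hc : c ∈ A.Z r), A.cls r c hc = x := by
  obtain ⟨⟨c, hc⟩, rfl⟩ := Submodule.Quotient.mk_surjective _ x
  exact ⟨c, hc, rfl⟩

/-- At the step where a cycle `c` enters, the homology is spanned by the class of `c` together
with the image of the homology of the previous step. -/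
lemma Filtration.homology_eq_map_add_smul_cls {m : ℕ} (F : Filtration m) (q i : ℕ) (h1 : 1 ≤ i)
    (h2 : i ≤ m) (c : (F.C i).X q) (hc : c ∈ (F.C i).Z q)
    (hcn : c ∉ LinearMap.range ((F.incl (Nat.sub_le i 1)).f q)) (x : (F.C i).homology q) :
    ∃ (y : (F.C (i - 1)).homology q) (ε : ZMod 2),
      x = (F.incl (Nat.sub_le i 1)).h q y + ε • (F.C i).cls q c hc := by
  have := F.findim i q
  have := F.findim (i - 1) q
  set f := (F.incl (Nat.sub_le i 1)).f q
  have hinj : Function.Injective f := F.inj i h1 h2 q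
  have hle : Module.finrank (ZMod 2) ((F.C i).X q)
      ≤ Module.finrank (ZMod 2) (LinearMap.range f) + 1 := by
    rw [LinearMap.finrank_range_of_inj hinj]
    by_cases hq : q = F.dimσ i
    · rw [hq]; exact (F.dim_step i h1 h2).le
    · rw [F.dim_eq i h1 h2 q hq]; exact Nat.le_succ _
  have hlt : LinearMap.range f < LinearMap.range f ⊔ Submodule.span (ZMod 2) {c} :=
    lt_of_le_of_ne le_sup_left fun h =>
      hcn (h ▸ Submodule.mem_sup_right (Submodule.mem_span_singleton_self c))
  have htop : LinearMap.range f ⊔ Submodule.span (ZMod 2) {c} = ⊤ :=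
    Submodule.eq_top_of_finrank_eq
      (le_antisymm (Submodule.finrank_le _) (hle.trans (Submodule.finrank_lt_finrank_of_lt hlt)))
  obtain ⟨w, hw, rfl⟩ := ChainCx.exists_cls_eq _ _ x
  obtain ⟨_, ⟨z, rfl⟩, s, hs, hzs⟩ := Submodule.mem_sup.mp (htop ▸ Submodule.mem_top (x := w))
  obtain ⟨ε, rfl⟩ := Submodule.mem_span_singleton.mp hs
  have hfz : f z ∈ (F.C i).Z q := by
    rw [eq_sub_of_add_eq hzs]
    exact Submodule.sub_mem _ hw (Submodule.smul_mem _ _ hc)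
  have hz : z ∈ (F.C (i - 1)).Z q := by
    apply F.inj i h1 h2 (q - 1)
    rw [map_zero]
    exact (LinearMap.congr_fun ((F.incl (Nat.sub_le i 1)).comm q) z).symm.trans hfz
  refine ⟨(F.C (i - 1)).cls q z hz, ε, ?_⟩
  subst hzs
  rfl

lemma Filtration.homology_zero_subsingleton {m : ℕ} (F : Filtration m) (q : ℕ) :
    Subsingleton ((F.C 0).homology q) := by
  have := F.zero_start q
  refine ⟨fun x y => ?_⟩
  obtain ⟨u, hu, rfl⟩ := ChainCx.exists_cls_eq _ _ x
  obtain ⟨v, hv, rfl⟩ := ChainCx.exists_cls_eq _ _ y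
  obtain rfl : u = v := Subsingleton.elim _ _
  rfl

/-- If `P_q^F ≅ ⊕_{j∈J} I^{[b_j,d_j)}` and `c` is a persistent `q`-cycle for
the interval `[b_{j₀}, d_{j₀})`, then there is a persistent `q`-basis `{c_j : j ∈ J}` for `F`
with the same intervals such that `c_{j₀} = c`. -/
theorem statement_3 (m : ℕ) (F : Filtration m) (q : ℕ) (J : Type) [Fintype J]
    [DecidableEq J] (b d : J → ℕ)
    (hb : ∀ j, 1 ≤ b j) (hbd : ∀ j, b j < d j) (hd : ∀ j, d j ≤ m + 1)
    (hiso : PersMod.IsoOn (F.Hq q) (PersMod.directSum J fun j => IntervalMod (b j) (d j)) m)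
    (j₀ : J) (c : (F.C (b j₀)).X q)
    (hpc : IsPersistentCycle F q (b j₀) (d j₀) (hbd j₀) c) :
    ∃ (c' : ∀ j, (F.C (b j)).X q) (hc' : ∀ j, c' j ∈ (F.C (b j)).Z q),
      c' j₀ = c ∧ IsPersistentBasis F q b d c' hc' := by
  obtain ⟨φ, hφ⟩ := hiso
  obtain ⟨hc, hcn, hdie⟩ := hpc
  have hbm (j : J) : b j ≤ m := Nat.lt_succ_iff.mp ((hbd j).trans_le (hd j))
  let x : (F.Hq q).V (b j₀) := (F.C (b j₀)).cls q c hc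
  let v : ∀ j, ↥(imSub (b j) (d j) (b j₀)) := φ (b j₀) (hb j₀) (hbm j₀) x
  have hv₀ : (v j₀ : ZMod 2) = 1 := by
    let e : ∀ j, ↥(imSub (b j) (d j) (b j₀)) := Pi.single j₀ ⟨1, by simp [imSub, hbd]⟩
    let ψ : (F.Hq q).V (b j₀) ≃ₗ[ZMod 2] (∀ j, ↥(imSub (b j) (d j) (b j₀))) :=
      φ (b j₀) (hb j₀) (hbm j₀)
    obtain ⟨y, ε, hy⟩ := F.homology_eq_map_add_smul_cls q (b j₀) (hb j₀) (hbm j₀) c hc hcn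
      (ψ.symm e)
    have hy₀ : (ψ ((F.Hq q).map (Nat.sub_le (b j₀) 1) y) j₀ : ZMod 2) = 0 := by
      by_cases h : 1 ≤ b j₀ - 1
      · have hn := hφ _ _ (Nat.sub_le (b j₀) 1) h (hbm j₀) y
        have hn₀ := (congrArg (fun w : ∀ j, ↥(imSub (b j) (d j) (b j₀)) => (w j₀ : ZMod 2))
          hn).trans (directSum_intervalMod_map_apply _ _ j₀)
        refine hn₀.trans (if_neg fun h' => ?_)
        have := h'.1
        omega
      · have : Subsingleton ((F.C (b j₀ - 1)).homology q) := by
          rw [show b j₀ - 1 = 0 by omega]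
          exact F.homology_zero_subsingleton q
        obtain rfl : y = 0 := Subsingleton.elim _ _
        have h0 : (F.Hq q).map (Nat.sub_le (b j₀) 1) 0 = 0 := map_zero _
        erw [h0, map_zero]
        rfl
    have he : e = ψ ((F.Hq q).map (Nat.sub_le (b j₀) 1) y) + ε • v := by
      rw [← ψ.apply_symm_apply e]
      refine (congrArg ψ hy).trans ?_
      refine (map_add ψ _ _).trans ?_
      congr 1
      exact map_smul ψ ε x
    have he₀ := congrArg (fun w : ∀ j, ↥(imSub (b j) (d j) (b j₀)) => (w j₀ : ZMod 2)) he
    simp only [e, Pi.single_eq_same, Pi.add_apply, Pi.smul_apply, Submodule.coe_add,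
      Submodule.coe_smul, hy₀, zero_add, smul_eq_mul] at he₀
    generalize (v j₀ : ZMod 2) = t at he₀
    clear hy he
    revert ε t
    decide
  have hv (j : J) (hj : (v j : ZMod 2) ≠ 0) : d j ≤ d j₀ := by
    by_contra! hlt
    have hdm : d j₀ ≤ m := Nat.lt_succ_iff.mp (hlt.trans_le (hd j))
    have hzero : (F.Hq q).map (hbd j₀).le x = 0 := (hdie hdm).2
    have hn := hφ _ _ (hbd j₀).le (hb j₀) hdm x
    rw [hzero, map_zero] at hn
    have hnj := (congrArg (fun w : ∀ j, ↥(imSub (b j) (d j) (d j₀)) => (w j : ZMod 2))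
      hn).trans (directSum_intervalMod_map_apply _ v j)
    have hbj : b j ≤ b j₀ := by
      by_contra h
      exact hj (eq_zero_of_mem_imSub (v j).2 fun h' => h h'.1)
    rw [if_pos ⟨hbj, hlt⟩] at hnj
    exact hj hnj.symm
  obtain ⟨φ', hφ', hφ'x⟩ := exists_decomposition_apply_eq_single φ hφ (hb j₀) (hbm j₀) (hbd j₀)
    x v rfl hv₀ hv
  have hrep (j : J) : ∃ (c' : (F.C (b j)).X q) (hc' : c' ∈ (F.C (b j)).Z q),
      (j = j₀ → c' ≍ c) ∧ φ' (b j) (hb j) (hbm j) ((F.C (b j)).cls q c' hc')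
        = Pi.single j ⟨1, by simp [imSub, hbd]⟩ := by
    by_cases hj : j = j₀
    · subst hj
      exact ⟨c, hc, fun _ => HEq.rfl, hφ'x⟩
    · obtain ⟨c', hc', h⟩ := ChainCx.exists_cls_eq _ _ ((φ' (b j) (hb j) (hbm j)).symm
        (Pi.single j ⟨1, by simp [imSub, hbd]⟩))
      exact ⟨c', hc', fun h' => absurd h' hj,
        (congrArg _ h).trans (LinearEquiv.apply_symm_apply _ _)⟩
  choose c' hc' hc₀ hgen using hrep
  refine ⟨c', hc', eq_of_heq (hc₀ j₀ rfl), φ', hφ', fun j i h1 h2 hbi hid => ?_⟩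
  refine (hφ' _ _ hbi (hb j) h2 _).trans ?_
  rw [hgen j]
  exact directSum_intervalMod_map_single hbi j le_rfl hid
end
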